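/- Let B be a bialgebra over a field k. Then B′ := ⋃_{n∈ℕ} ker δ_{n+1} is a subbialgebra of B (a subalgebra containing 1 with Δ(B′) ⊆ B′ ⊗ B′), and B′ is a Hopf algebra: there exists a linear map S : B′ → B′ which is a convolution inverse of the identity of B′, i.e. Σ_{(b)} S(b₍₁₎)·b₍₂₎ = ε(b)·1 = Σ_{(b)} b₍₁₎·S(b₍₂₎) for all b ∈ B′. (Corollary 3.4(b)) -/

import Mathlib

open TensorProduct PiTensorProduct

noncomputable section

namespace CDP

variable (k : Type) [Field k] (C : Type) [AddCommGroup C] [Module k C]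

/-- The canonical equivalence `⨂[k]^1 C ≃ C`. -/
def tpowOne : (⨂[k]^1 C) ≃ₗ[k] C := PiTensorProduct.subsingletonEquiv (0 : Fin 1)

/-- Splitting a tensor power. -/
def tpowSplit (a b : ℕ) : (⨂[k]^(a+b) C) ≃ₗ[k] (⨂[k]^a C) ⊗[k] (⨂[k]^b C) :=
  (PiTensorProduct.reindex k (fun _ : Fin (a+b) => C) finSumFinEquiv.symm).trans
    (PiTensorProduct.tmulEquiv k C).symm

/-- Prepending a tensor factor. -/
def consTP (n : ℕ) : C ⊗[k] (⨂[k]^n C) →ₗ[k] ⨂[k]^(n+1) C :=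
  (PiTensorProduct.reindex k (fun _ : Fin (1+n) => C)
      (finCongr (Nat.add_comm 1 n))).toLinearMap ∘ₗ
    (tpowSplit k C 1 n).symm.toLinearMap ∘ₗ
    (TensorProduct.map (tpowOne k C).symm.toLinearMap LinearMap.id)

variable {C} in
/-- The iterated comultiplication `Δ^n : C → C^{⊗ n}`, with `Δ^0 := ε`. -/
def DeltaIter (comul : C →ₗ[k] C ⊗[k] C) (counit : C →ₗ[k] k) :
    (n : ℕ) → (C →ₗ[k] ⨂[k]^n C)
  | 0 => (PiTensorProduct.isEmptyEquiv (Fin 0)).symm.toLinearMap ∘ₗ counit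
  | n+1 => consTP k C n ∘ₗ
      (TensorProduct.map LinearMap.id (DeltaIter comul counit n)) ∘ₗ comul

variable {C} in
/-- The projection `id - u ∘ ε` associated to the coaugmentation `one = u(1)`. -/
def proj (counit : C →ₗ[k] k) (one : C) : C →ₗ[k] C :=
  LinearMap.id - (LinearMap.toSpanSingleton k C one) ∘ₗ counit

variable {C} in
/-- Drinfeld's maps `δ_n := (id - u∘ε)^{⊗n} ∘ Δ^n`. -/
def deltaN (comul : C →ₗ[k] C ⊗[k] C) (counit : C →ₗ[k] k) (one : C) (n : ℕ) :
    C →ₗ[k] ⨂[k]^n C :=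
  (PiTensorProduct.map fun _ : Fin n => proj k counit one) ∘ₗ DeltaIter k comul counit n

variable {C} in
/-- The `δ`-filtration `D_n := ker δ_{n+1}`. -/
def Dfil (comul : C →ₗ[k] C ⊗[k] C) (counit : C →ₗ[k] k) (one : C) (n : ℕ) :
    Submodule k C :=
  LinearMap.ker (deltaN k comul counit one (n+1))

/-- For subspaces `X, Y ⊆ C`, the subspace `X ⊗ Y ⊆ C ⊗ C`. -/
def tsub (X Y : Submodule k C) : Submodule k (C ⊗[k] C) :=
  LinearMap.range (TensorProduct.map X.subtype Y.subtype)

end CDP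


namespace CDP

section cons
variable (k : Type) [Field k] (C : Type) [AddCommGroup C] [Module k C]

lemma consTP_tprod (n : ℕ) (c : C) (v : Fin n → C) :
    consTP k C n (c ⊗ₜ PiTensorProduct.tprod k v) =
      PiTensorProduct.tprod k (Fin.cons c v : Fin (n+1) → C) := by
  have h1 : (tpowOne k C).symm c = PiTensorProduct.tprod k (fun _ : Fin 1 => c) :=
    PiTensorProduct.subsingletonEquiv_symm_apply' (0 : Fin 1) c
  simp only [consTP, LinearMap.comp_apply, TensorProduct.map_tmul, LinearEquiv.coe_coe, h1,
    LinearMap.id_apply, tpowSplit, LinearEquiv.trans_symm, LinearEquiv.symm_symm,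
    LinearEquiv.trans_apply]
  rw [PiTensorProduct.tmulEquiv_apply]
  rw [PiTensorProduct.reindex_symm]
  erw [PiTensorProduct.reindex_tprod, PiTensorProduct.reindex_tprod]
  congr 1
  funext i
  refine Fin.cases ?_ (fun j => ?_) i
  · have : finSumFinEquiv.symm ((finCongr (Nat.add_comm 1 n)).symm (0 : Fin (n+1))) =
        (Sum.inl 0 : Fin 1 ⊕ Fin n) := by
      rw [Equiv.symm_apply_eq]; rfl
    simp only [Equiv.symm_symm]
    erw [this]; rfl
  · have : finSumFinEquiv.symm ((finCongr (Nat.add_comm 1 n)).symm j.succ) =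
        (Sum.inr j : Fin 1 ⊕ Fin n) := by
      rw [Equiv.symm_apply_eq]
      ext; simp; omega
    simp only [Equiv.symm_symm]
    erw [this]; rfl

lemma consTP_injective (n : ℕ) : Function.Injective (consTP k C n) := by
  have h : consTP k C n = ((TensorProduct.congr (tpowOne k C).symm (LinearEquiv.refl k _)).trans
      ((tpowSplit k C 1 n).symm.trans (PiTensorProduct.reindex k (fun _ : Fin (1+n) => C)
      (finCongr (Nat.add_comm 1 n))))).toLinearMap := rfl
  rw [h]
  exact LinearEquiv.injective _

lemma map_consTP (f : C →ₗ[k] C) (n : ℕ) :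
    (PiTensorProduct.map fun _ : Fin (n+1) => f) ∘ₗ consTP k C n =
      consTP k C n ∘ₗ TensorProduct.map f (PiTensorProduct.map fun _ : Fin n => f) := by
  ext c v
  simp only [LinearMap.compMultilinearMap_apply, TensorProduct.AlgebraTensorModule.curry_apply,
    TensorProduct.curry_apply, LinearMap.restrictScalars_self, LinearMap.comp_apply,
    TensorProduct.map_tmul, PiTensorProduct.map_tprod, consTP_tprod]
  congr 1
  funext i
  refine Fin.cases ?_ (fun j => ?_) i <;> simp

end cons

section bialg
variable (k : Type) [Field k] (B : Type) [Ring B] [Bialgebra k B]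

/-- `B ⊗ N` inside `B ⊗ B`. -/
def TB (N : Submodule k B) : Submodule k (B ⊗[k] B) := LinearMap.range (N.subtype.lTensor B)

variable {k B} in
lemma tmul_mem_TB {N : Submodule k B} (a : B) {c : B} (hc : c ∈ N) : a ⊗ₜ[k] c ∈ TB k B N :=
  ⟨a ⊗ₜ ⟨c, hc⟩, by simp⟩

variable {k B} in
lemma TB_le {N : Submodule k B} {M : Submodule k (B ⊗[k] B)}
    (h : ∀ a, ∀ c ∈ N, a ⊗ₜ[k] c ∈ M) : TB k B N ≤ M := by
  rintro _ ⟨x, rfl⟩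
  induction x with
  | zero => simp
  | tmul a c => simpa using h a c c.2
  | add x y hx hy => rw [map_add]; exact M.add_mem hx hy

variable {k B} in
lemma TB_mono {N M : Submodule k B} (h : N ≤ M) : TB k B N ≤ TB k B M :=
  TB_le fun a _ hc => tmul_mem_TB a (h hc)

/-- `b ↦ Δ b - 1 ⊗ b`. -/
def dl : B →ₗ[k] B ⊗[k] B := Coalgebra.comul - TensorProduct.mk k B B 1

lemma dl_apply (b : B) : dl k B b = Coalgebra.comul b - 1 ⊗ₜ[k] b := rfl

/-- The filtration, recursively. -/
def Fil : ℕ → Submodule k B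
  | 0 => ⊥
  | n+1 => (TB k B (Fil n)).comap (dl k B)

lemma mem_Fil_succ (n : ℕ) (b : B) : b ∈ Fil k B (n+1) ↔ dl k B b ∈ TB k B (Fil k B n) := Iff.rfl

lemma Fil_le_succ (n : ℕ) : Fil k B n ≤ Fil k B (n+1) := by
  induction n with
  | zero => exact bot_le
  | succ n ih => exact fun b hb => TB_mono ih hb

lemma Fil_mono : Monotone (Fil k B) := monotone_nat_of_le_succ (Fil_le_succ k B)

/-- `p = id - u ε` -/
abbrev pp : B →ₗ[k] B := proj k Coalgebra.counit (1 : B)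

lemma pp_rTensor (b : B) : (pp k B).rTensor B (Coalgebra.comul b) = dl k B b := by
  have h := Coalgebra.rTensor_counit_comul (R := k) b
  have h2 : (LinearMap.toSpanSingleton k B (1:B) ∘ₗ Coalgebra.counit (R := k)).rTensor B
      (Coalgebra.comul b) = 1 ⊗ₜ[k] b := by
    rw [LinearMap.rTensor_comp, LinearMap.comp_apply, h]; simp
  rw [pp, proj, LinearMap.rTensor_sub, LinearMap.sub_apply, h2, dl_apply]; simp

lemma ker_lTensor' {V : Type} [AddCommGroup V] [Module k V] (f : B →ₗ[k] V) (x : B ⊗[k] B) :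
    f.lTensor B x = 0 ↔ x ∈ TB k B (LinearMap.ker f) :=
  (Module.Flat.lTensor_exact B (f.exact_subtype_ker_map)) x

lemma deltaN_succ (n : ℕ) (b : B) :
    deltaN k Coalgebra.comul Coalgebra.counit (1 : B) (n+1) b = 0 ↔
      dl k B b ∈ TB k B (LinearMap.ker (deltaN k Coalgebra.comul Coalgebra.counit (1 : B) n)) := by
  rw [← ker_lTensor', ← pp_rTensor, ← LinearMap.comp_apply (LinearMap.lTensor _ _),
    LinearMap.lTensor_comp_rTensor, deltaN, DeltaIter, ← LinearMap.comp_assoc, map_consTP,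
    LinearMap.comp_assoc, LinearMap.comp_apply, ← (consTP k B n).map_zero,
    (consTP_injective k B n).eq_iff, ← LinearMap.comp_assoc, ← TensorProduct.map_comp]
  rfl

lemma Dfil_eq (n : ℕ) : Dfil k Coalgebra.comul Coalgebra.counit (1 : B) n = Fil k B (n+1) := by
  induction n with
  | zero =>
    ext b
    rw [Dfil, LinearMap.mem_ker, deltaN_succ, mem_Fil_succ]
    constructor
    · intro h
      have h0 : LinearMap.ker (deltaN k Coalgebra.comul Coalgebra.counit (1 : B) 0) ≤
          LinearMap.ker (Coalgebra.counit (R := k) (A := B)) := by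
        intro c hc
        have hm : ((PiTensorProduct.isEmptyEquiv (Fin 0)).toLinearMap ∘ₗ
            PiTensorProduct.map fun _ : Fin 0 => pp k B) =
            (PiTensorProduct.isEmptyEquiv (Fin 0)).toLinearMap := by
          ext v; simp
        have hc2 := congrArg (PiTensorProduct.isEmptyEquiv (Fin 0)) (LinearMap.mem_ker.1 hc)
        have h3 := LinearMap.congr_fun hm
          ((PiTensorProduct.isEmptyEquiv (Fin 0)).symm (Coalgebra.counit (R := k) c))
        rw [map_zero] at hc2
        simp only [LinearMap.comp_apply, LinearEquiv.coe_coe, LinearEquiv.apply_symm_apply] at h3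
        rw [LinearMap.mem_ker, ← h3]
        exact hc2
      replace h := TB_mono h0 h
      rw [← ker_lTensor', dl_apply, map_sub, Coalgebra.lTensor_counit_comul,
        LinearMap.lTensor_tmul, sub_eq_zero] at h
      have h1 := congrArg (TensorProduct.rid k B) h
      simp at h1
      have : dl k B b = 0 := by
        rw [h1]; simp [dl_apply, Algebra.TensorProduct.one_def]
      rw [this]; exact Submodule.zero_mem _
    · exact fun h => TB_mono bot_le h
  | succ n ih =>
    ext b
    rw [Dfil, LinearMap.mem_ker, deltaN_succ, mem_Fil_succ, ← ih]; rfl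

lemma one_mem : (1 : B) ∈ Fil k B 1 := by
  rw [mem_Fil_succ, dl_apply, Bialgebra.comul_one, Algebra.TensorProduct.one_def, sub_self]
  exact Submodule.zero_mem _

lemma TB_mul {N M L : Submodule k B} (h : ∀ x ∈ N, ∀ y ∈ M, x * y ∈ L) (x y : B ⊗[k] B)
    (hx : x ∈ TB k B N) (hy : y ∈ TB k B M) : x * y ∈ TB k B L := by
  have h1 : TB k B N ≤ (TB k B L).comap (LinearMap.mulRight k y) := by
    refine TB_le fun a c hc => ?_
    have h2 : TB k B M ≤ (TB k B L).comap (LinearMap.mulLeft k (a ⊗ₜ[k] c)) := by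
      refine TB_le fun a' c' hc' => ?_
      simpa using tmul_mem_TB _ (h c hc c' hc')
    simpa using h2 hy
  exact h1 hx

lemma mul_mem' (m n : ℕ) : ∀ a ∈ Fil k B m, ∀ b ∈ Fil k B n, a * b ∈ Fil k B (m+n) := by
  induction m generalizing n with
  | zero => intro a ha b _; rw [(Submodule.mem_bot k).1 ha, zero_mul]; exact Submodule.zero_mem _
  | succ m ihm =>
    induction n with
    | zero => intro a _ b hb; rw [(Submodule.mem_bot k).1 hb, mul_zero]; exact Submodule.zero_mem _
    | succ n ihn =>
      intro a ha b hb
      have key : dl k B (a * b) = (1 ⊗ₜ[k] a) * dl k B b + dl k B a * (1 ⊗ₜ[k] b)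
          + dl k B a * dl k B b := by
        have : (1 : B) ⊗ₜ[k] (a * b) = (1 ⊗ₜ[k] a) * (1 ⊗ₜ[k] b) := by simp
        rw [dl_apply, dl_apply, dl_apply, Bialgebra.comul_mul, this]; noncomm_ring
      show dl k B (a * b) ∈ TB k B (Fil k B (m + 1 + n))
      rw [key]
      refine Submodule.add_mem _ (Submodule.add_mem _ ?_ ?_) ?_
      · exact TB_mul k B ihn _ _ (tmul_mem_TB 1 ha) hb
      · refine TB_mul k B (N := Fil k B m) (M := Fil k B (n+1)) ?_ _ _ ha (tmul_mem_TB 1 hb)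
        intro x hx y hy
        have := ihm (n+1) x hx y hy
        rwa [show m + 1 + n = m + (n+1) by omega]
      · refine TB_mul k B (N := Fil k B m) (M := Fil k B n) ?_ _ _ ha hb
        intro x hx y hy
        exact Fil_mono k B (by omega) (ihm n x hx y hy)

/-- slice by a functional -/
def sl (g : B →ₗ[k] k) : B ⊗[k] B →ₗ[k] B := (TensorProduct.rid k B).toLinearMap ∘ₗ g.lTensor B

lemma sl_tmul (g : B →ₗ[k] k) (a b : B) : sl k B g (a ⊗ₜ b) = g b • a := by simp [sl]

lemma dl_sl (g : B →ₗ[k] k) (b : B) :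
    dl k B (sl k B g (dl k B b)) = (sl k B g ∘ₗ Coalgebra.comul).lTensor B (dl k B b) := by
  have h1 : ∀ z : B ⊗[k] B, Coalgebra.comul (R := k) (sl k B g z) =
      (sl k B g).lTensor B (TensorProduct.assoc k B B B (Coalgebra.comul.rTensor B z)) := by
    intro z
    induction z with
    | zero => simp
    | add x y hx hy => simp only [map_add, hx, hy]
    | tmul a c =>
      rw [sl_tmul, map_smul, LinearMap.rTensor_tmul]
      generalize Coalgebra.comul (R := k) a = w
      induction w with
      | zero => simp
      | add x y hx hy => simp only [smul_add, TensorProduct.add_tmul, map_add, hx, hy]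
      | tmul u v => simp [sl_tmul]
  rw [dl_apply k B (sl k B g (dl k B b)), h1]
  have h2 : (1 : B) ⊗ₜ[k] (sl k B g (dl k B b)) = (sl k B g).lTensor B (1 ⊗ₜ dl k B b) := by simp
  rw [h2, ← map_sub, LinearMap.lTensor_comp, LinearMap.comp_apply]
  congr 1
  simp only [dl_apply, map_sub, Coalgebra.coassoc_apply, LinearMap.rTensor_tmul,
    LinearMap.lTensor_tmul, Bialgebra.comul_one, Algebra.TensorProduct.one_def,
    TensorProduct.assoc_tmul, TensorProduct.tmul_sub]
  abel

variable {k B} in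
lemma tmul_mem_tsub {N M : Submodule k B} {a c : B} (ha : a ∈ N) (hc : c ∈ M) :
    a ⊗ₜ[k] c ∈ tsub k B N M :=
  ⟨⟨a, ha⟩ ⊗ₜ ⟨c, hc⟩, by simp⟩

variable {k B} in
lemma tsub_le {N N' : Submodule k B} {M : Submodule k (B ⊗[k] B)}
    (h : ∀ a ∈ N, ∀ c ∈ N', a ⊗ₜ[k] c ∈ M) : tsub k B N N' ≤ M := by
  rintro _ ⟨x, rfl⟩
  induction x with
  | zero => simp
  | tmul a c => simpa using h a a.2 c c.2
  | add x y hx hy => rw [map_add]; exact M.add_mem hx hy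

lemma comul_mem (n : ℕ) : ∀ b ∈ Fil k B n,
    Coalgebra.comul (R := k) b ∈ tsub k B (Fil k B n) (Fil k B n) := by
  induction n with
  | zero => intro b hb; rw [(Submodule.mem_bot k).1 hb, map_zero]; exact Submodule.zero_mem _
  | succ n ih =>
    intro b hb
    have hs : ∀ g : B →ₗ[k] k, sl k B g (dl k B b) ∈ Fil k B (n+1) := by
      intro g
      rw [mem_Fil_succ, dl_sl]
      have : TB k B (Fil k B n) ≤ (TB k B (Fil k B n)).comap
          ((sl k B g ∘ₗ Coalgebra.comul).lTensor B) := by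
        refine TB_le fun a c hc => ?_
        refine tmul_mem_TB a ?_
        have h3 : tsub k B (Fil k B n) (Fil k B n) ≤ (Fil k B n).comap (sl k B g) := by
          refine tsub_le fun u hu v _ => ?_
          rw [Submodule.mem_comap, sl_tmul]
          exact Submodule.smul_mem _ _ hu
        exact h3 (ih c hc)
      exact this hb
    have hX : dl k B b ∈ tsub k B (Fil k B (n+1)) (Fil k B (n+1)) := by
      obtain ⟨x, hx⟩ := (mem_Fil_succ k B n b).1 hb
      classical
      let e := Module.Basis.ofVectorSpace k (Fil k B n)
      have hx2 := (TensorProduct.equivFinsuppOfBasisRight (M := B) e).symm_apply_apply x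
      rw [TensorProduct.equivFinsuppOfBasisRight_symm_apply] at hx2
      rw [← hx, ← hx2, Finsupp.sum, map_sum]
      refine Submodule.sum_mem _ fun i _ => ?_
      rw [LinearMap.lTensor_tmul]
      refine tmul_mem_tsub ?_ (Fil_le_succ k B n (e i).2)
      obtain ⟨g, hg⟩ := LinearMap.exists_extend (e.coord i)
      rw [TensorProduct.equivFinsuppOfBasisRight_apply, ← hg, LinearMap.lTensor_comp,
        LinearMap.comp_apply, hx]
      exact hs g
    have h1 : Coalgebra.comul (R := k) b = dl k B b + 1 ⊗ₜ b := by rw [dl_apply]; abel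
    rw [h1]
    exact Submodule.add_mem _ hX (tmul_mem_tsub (Fil_mono k B (by omega) (one_mem k B)) hb)

/-- the convolution powers of `p` vanish on the filtration -/
lemma pow_zero_on (n : ℕ) : ∀ b ∈ Fil k B n, ((WithConv.toConv (pp k B))^n).ofConv b = 0 := by
  induction n with
  | zero => intro b hb; rw [(Submodule.mem_bot k).1 hb, map_zero]
  | succ n ih =>
    intro b hb
    rw [pow_succ', LinearMap.convMul_def]
    set q := ((WithConv.toConv (pp k B))^n).ofConv
    show LinearMap.mul' k B (TensorProduct.map (pp k B) q (Coalgebra.comul b)) = 0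
    rw [← LinearMap.lTensor_comp_rTensor, LinearMap.comp_apply, pp_rTensor]
    have : TB k B (Fil k B n) ≤ LinearMap.ker (LinearMap.mul' k B ∘ₗ q.lTensor B) := by
      refine TB_le fun a c hc => ?_
      simp [ih c hc]
    exact this hb

lemma pow_zero_on' {m n : ℕ} (h : m ≤ n) (b : B) (hb : b ∈ Fil k B m) :
    ((WithConv.toConv (pp k B))^n).ofConv b = 0 :=
  pow_zero_on k B n b (Fil_mono k B h hb)

/-- The union of the filtration. -/
def BB : Submodule k B := ⨆ n, Fil k B n

lemma mem_BB (b : B) : b ∈ BB k B ↔ ∃ n, b ∈ Fil k B n :=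
  Submodule.mem_iSup_of_directed _ (Fil_mono k B).directed_le

lemma BB_one : (1 : B) ∈ BB k B := (mem_BB k B 1).2 ⟨1, one_mem k B⟩

lemma BB_mul {a b : B} (ha : a ∈ BB k B) (hb : b ∈ BB k B) : a * b ∈ BB k B := by
  obtain ⟨m, ha⟩ := (mem_BB k B a).1 ha
  obtain ⟨n, hb⟩ := (mem_BB k B b).1 hb
  exact (mem_BB k B _).2 ⟨m + n, mul_mem' k B m n a ha b hb⟩

lemma BB_comul {b : B} (hb : b ∈ BB k B) :
    Coalgebra.comul (R := k) b ∈ tsub k B (BB k B) (BB k B) := by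
  obtain ⟨n, hb⟩ := (mem_BB k B b).1 hb
  exact (tsub_le fun a ha c hc => tmul_mem_tsub ((mem_BB k B a).2 ⟨n, ha⟩)
    ((mem_BB k B c).2 ⟨n, hc⟩)) (comul_mem k B n b hb)

lemma pow_mem_BB (i : ℕ) : ∀ b ∈ BB k B,
    ((WithConv.toConv (pp k B))^i).ofConv b ∈ BB k B := by
  induction i with
  | zero =>
    intro b _
    rw [pow_zero, LinearMap.convOne_def]
    show algebraMap k B (Coalgebra.counit b) ∈ BB k B
    rw [Algebra.algebraMap_eq_smul_one]
    exact Submodule.smul_mem _ _ (BB_one k B)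
  | succ i ih =>
    intro b hb
    rw [pow_succ', LinearMap.convMul_def]
    set q := ((WithConv.toConv (pp k B))^i).ofConv
    show LinearMap.mul' k B (TensorProduct.map (pp k B) q (Coalgebra.comul b)) ∈ BB k B
    have : tsub k B (BB k B) (BB k B) ≤
        (BB k B).comap (LinearMap.mul' k B ∘ₗ TensorProduct.map (pp k B) q) := by
      refine tsub_le fun a ha c hc => ?_
      show pp k B a * q c ∈ BB k B
      refine BB_mul k B ?_ (ih c hc)
      show a - Coalgebra.counit (R := k) a • (1 : B) ∈ BB k B
      exact Submodule.sub_mem _ ha (Submodule.smul_mem _ _ (BB_one k B))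
    exact this (BB_comul k B hb)

/-- `- p` in the convolution ring. -/
def QQ : WithConv (B →ₗ[k] B) := - WithConv.toConv (pp k B)

lemma QQ_pow (n : ℕ) : QQ k B ^ n = (WithConv.toConv (pp k B))^n ∨
    QQ k B ^ n = - (WithConv.toConv (pp k B))^n := by
  rw [QQ, neg_pow]
  rcases neg_one_pow_eq_or (WithConv (B →ₗ[k] B)) n with h | h <;> rw [h] <;> simp

lemma one_sub_QQ : 1 - QQ k B = WithConv.toConv LinearMap.id := by
  ext b
  show algebraMap k B (Coalgebra.counit b) - (-(b - Coalgebra.counit (R := k) b • (1 : B))) = b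
  rw [Algebra.algebraMap_eq_smul_one]; abel

/-- partial sums of the geometric series -/
def ss (n : ℕ) : WithConv (B →ₗ[k] B) := ∑ i ∈ Finset.range n, QQ k B ^ i

lemma QQ_zero_on {m n : ℕ} (h : m ≤ n) (b : B) (hb : b ∈ Fil k B m) :
    (QQ k B ^ n).ofConv b = 0 := by
  have := pow_zero_on' k B h b hb
  rcases QQ_pow k B n with h | h <;> rw [h] <;> simp [this]

lemma ss_succ (n : ℕ) (b : B) :
    (ss k B (n+1)).ofConv b = (ss k B n).ofConv b + (QQ k B ^ n).ofConv b := by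
  rw [ss, Finset.sum_range_succ]; rfl

lemma ss_stable {m n : ℕ} (h : m ≤ n) (b : B) (hb : b ∈ Fil k B m) :
    (ss k B n).ofConv b = (ss k B m).ofConv b := by
  induction n, h using Nat.le_induction with
  | base => rfl
  | succ n hmn ih => rw [ss_succ, ih, QQ_zero_on k B hmn b hb, add_zero]

lemma ss_mem (n : ℕ) (b : B) (hb : b ∈ BB k B) : (ss k B n).ofConv b ∈ BB k B := by
  induction n with
  | zero => exact Submodule.zero_mem _
  | succ n ih =>
    rw [ss_succ]
    refine Submodule.add_mem _ ih ?_
    have := pow_mem_BB k B n b hb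
    rcases QQ_pow k B n with h | h <;> rw [h]
    · exact this
    · exact Submodule.neg_mem _ this

lemma exists_S : ∃ S : B →ₗ[k] B, ∀ n, ∀ b ∈ Fil k B n, S b = (ss k B n).ofConv b := by
  have hN : ∀ b : BB k B, ∃ n, (b : B) ∈ Fil k B n := fun b => (mem_BB k B b).1 b.2
  choose N hN using hN
  have key : ∀ (b : BB k B) n, (b : B) ∈ Fil k B n →
      (ss k B (N b)).ofConv (b : B) = (ss k B n).ofConv (b : B) := by
    intro b n hn
    rw [← ss_stable k B (le_max_left (N b) n) b (hN b), ss_stable k B (le_max_right (N b) n) b hn]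
  let S0 : BB k B →ₗ[k] B :=
    { toFun := fun b => (ss k B (N b)).ofConv (b : B)
      map_add' := by
        intro a b
        have ha := Fil_mono k B (le_max_left (N a) (N b)) (hN a)
        have hb := Fil_mono k B (le_max_right (N a) (N b)) (hN b)
        rw [key a _ ha, key b _ hb, key (a + b) _ (Submodule.add_mem _ ha hb)]
        simp
      map_smul' := by
        intro c a
        rw [key (c • a) _ (Submodule.smul_mem _ c (hN a))]
        simp }
  obtain ⟨S, hS⟩ := LinearMap.exists_extend S0
  refine ⟨S, fun n b hb => ?_⟩
  have hb' : b ∈ BB k B := (mem_BB k B b).2 ⟨n, hb⟩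
  have := LinearMap.congr_fun hS ⟨b, hb'⟩
  exact this.trans (key ⟨b, hb'⟩ n hb)

lemma antipode {S : B →ₗ[k] B} (hS : ∀ n, ∀ b ∈ Fil k B n, S b = (ss k B n).ofConv b)
    (n : ℕ) (b : B) (hb : b ∈ Fil k B n) :
    (LinearMap.mul' k B) ((TensorProduct.map S LinearMap.id) (Coalgebra.comul b)) =
      (Coalgebra.counit b : k) • (1 : B) ∧
    (LinearMap.mul' k B) ((TensorProduct.map LinearMap.id S) (Coalgebra.comul b)) =
      (Coalgebra.counit b : k) • (1 : B) := by
  have h0 : (1 - QQ k B ^ n).ofConv b = (Coalgebra.counit b : k) • (1 : B) := by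
    rw [WithConv.ofConv_sub, LinearMap.sub_apply, QQ_zero_on k B le_rfl b hb, sub_zero,
      ← Algebra.algebraMap_eq_smul_one]
    rfl
  constructor
  · have h1 : tsub k B (Fil k B n) (Fil k B n) ≤ LinearMap.eqLocus (TensorProduct.map S LinearMap.id)
        (TensorProduct.map (ss k B n).ofConv LinearMap.id) :=
      tsub_le fun a ha c _ => by
        simp [LinearMap.mem_eqLocus, hS n a ha]
    have h2 := h1 (comul_mem k B n b hb)
    rw [LinearMap.mem_eqLocus] at h2
    rw [h2, ← h0, ← geom_sum_mul_neg, one_sub_QQ]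
    rfl
  · have h1 : tsub k B (Fil k B n) (Fil k B n) ≤ LinearMap.eqLocus (TensorProduct.map LinearMap.id S)
        (TensorProduct.map LinearMap.id (ss k B n).ofConv) :=
      tsub_le fun a _ c hc => by
        simp [LinearMap.mem_eqLocus, hS n c hc]
    have h2 := h1 (comul_mem k B n b hb)
    rw [LinearMap.mem_eqLocus] at h2
    rw [h2, ← h0, ← mul_neg_geom_sum, one_sub_QQ]
    rfl

lemma iSup_Dfil : (⨆ n : ℕ, Dfil k Coalgebra.comul Coalgebra.counit (1 : B) n) = BB k B := by
  simp only [Dfil_eq]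
  apply le_antisymm
  · exact iSup_le fun n => le_iSup (Fil k B) (n+1)
  · exact iSup_le fun n => (Fil_le_succ k B n).trans (le_iSup (fun n => Fil k B (n+1)) n)

end bialg
end CDP

open CDP

/-- **Corollary 3.4(b).** Let `B` be a bialgebra over a field `k`.  Then
`B′ := ⋃_{n∈ℕ} ker δ_{n+1}` is a subbialgebra of `B` (a subalgebra containing
`1` with `Δ(B′) ⊆ B′ ⊗ B′`), and `B′` is a Hopf algebra: there exists a linear
map `S` preserving `B′` which is a convolution inverse of the identity of
`B′`, i.e. `Σ S(b₍₁₎)·b₍₂₎ = ε(b)·1 = Σ b₍₁₎·S(b₍₂₎)` for all `b ∈ B′`. -/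
theorem connected_part_is_hopf
    (k : Type) [Field k] (B : Type) [Ring B] [Bialgebra k B] :
    (1 : B) ∈ (⨆ n : ℕ, Dfil k Coalgebra.comul Coalgebra.counit (1 : B) n) ∧
    (⨆ n : ℕ, Dfil k Coalgebra.comul Coalgebra.counit (1 : B) n) *
        (⨆ n : ℕ, Dfil k Coalgebra.comul Coalgebra.counit (1 : B) n) ≤
      (⨆ n : ℕ, Dfil k Coalgebra.comul Coalgebra.counit (1 : B) n) ∧
    Submodule.map (Coalgebra.comul : B →ₗ[k] B ⊗[k] B)
        (⨆ n : ℕ, Dfil k Coalgebra.comul Coalgebra.counit (1 : B) n) ≤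
      tsub k B (⨆ n : ℕ, Dfil k Coalgebra.comul Coalgebra.counit (1 : B) n)
        (⨆ n : ℕ, Dfil k Coalgebra.comul Coalgebra.counit (1 : B) n) ∧
    ∃ S : B →ₗ[k] B,
      Submodule.map S (⨆ n : ℕ, Dfil k Coalgebra.comul Coalgebra.counit (1 : B) n) ≤
        (⨆ n : ℕ, Dfil k Coalgebra.comul Coalgebra.counit (1 : B) n) ∧
      ∀ b ∈ (⨆ n : ℕ, Dfil k Coalgebra.comul Coalgebra.counit (1 : B) n),
        (LinearMap.mul' k B) ((TensorProduct.map S LinearMap.id) (Coalgebra.comul b)) =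
          (Coalgebra.counit b : k) • (1 : B) ∧
        (LinearMap.mul' k B) ((TensorProduct.map LinearMap.id S) (Coalgebra.comul b)) =
          (Coalgebra.counit b : k) • (1 : B) := by
  rw [iSup_Dfil]
  refine ⟨BB_one k B, Submodule.mul_le.2 fun a ha b hb => BB_mul k B ha hb, ?_, ?_⟩
  · rintro _ ⟨b, hb, rfl⟩
    exact BB_comul k B hb
  · obtain ⟨S, hS⟩ := exists_S k B
    refine ⟨S, ?_, ?_⟩
    · rintro _ ⟨b, hb, rfl⟩
      obtain ⟨n, hn⟩ := (mem_BB k B b).1 hb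
      rw [hS n b hn]
      exact ss_mem k B n b hb
    · intro b hb
      obtain ⟨n, hn⟩ := (mem_BB k B b).1 hb
      exact antipode k B hS n b hn
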